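/- arXiv:2108.07989 — 2 statements merged into one kernel-verified Lean document; each statement's English description precedes it below -/
import Mathlib

section
/- Let Ω ⊂ ℝ^N be a bounded domain. There exists a function t ↦ D_t defined for t ≥ 2 such that for every t ≥ 2 and every u ∈ C_c^∞(Ω), ‖u‖_{L^t(Ω)} ≤ D_t · t^{(N-1)/N} · (∫_Ω H(∇u)^N dx)^{1/N}, and moreover lim_{t→∞} D_t = (1/(N κ_N^{1/N})) ((N-1)/(Ne))^{(N-1)/N}. -/
open MeasureTheory Filter Real Set
open scoped RealInnerProductSpace Topology NNReal

noncomputable section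

abbrev Euc (N : ℕ) := EuclideanSpace ℝ (Fin N)

/-- `H` is a norm on `ℝ^N`: convex, nonnegative, vanishing exactly at `0`,
and absolutely homogeneous. -/
def IsFinslerNorm (N : ℕ) (H : Euc N → ℝ) : Prop :=
  ConvexOn ℝ Set.univ H ∧
  (∀ ξ, 0 ≤ H ξ) ∧
  (∀ ξ, H ξ = 0 ↔ ξ = 0) ∧
  (∀ (t : ℝ) (ξ : Euc N), H (t • ξ) = |t| * H ξ)

/-- Regularity assumptions: `H ∈ C²(ℝ^N \ {0})`, `H^N ∈ C¹(ℝ^N)`, and the Hessian of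
`H^N` is positive definite away from the origin. -/
def FinslerRegular (N : ℕ) (H : Euc N → ℝ) : Prop :=
  ContDiffOn ℝ 2 H {(0 : Euc N)}ᶜ ∧
  ContDiff ℝ 1 (fun ξ => H ξ ^ N) ∧
  ∀ ξ : Euc N, ξ ≠ 0 → ∀ v : Euc N, v ≠ 0 →
    0 < iteratedFDeriv ℝ 2 (fun ξ => H ξ ^ N) ξ ![v, v]

/-- The dual norm `H⁰(x) = sup_{ξ ≠ 0} ⟪x, ξ⟫ / H(ξ)`. -/
def dualNorm {N : ℕ} (H : Euc N → ℝ) (x : Euc N) : ℝ :=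
  sSup {r : ℝ | ∃ ξ : Euc N, ξ ≠ 0 ∧ r = ⟪x, ξ⟫ / H ξ}

/-- `κ_N`, the volume of the Wulff ball `{H⁰ < 1}`. -/
def wulffVol (N : ℕ) (H : Euc N → ℝ) : ℝ :=
  (volume {x : Euc N | dualNorm H x < 1}).toReal

/-- `β_N = N (N κ_N)^{1/(N-1)}`. -/
def betaN (N : ℕ) (H : Euc N → ℝ) : ℝ :=
  N * (N * wulffVol N H) ^ ((1 : ℝ) / ((N : ℝ) - 1))

/-- `u` is a weak solution of `-Q_N u = g` on the open set `U`:
`∫_U H(∇u)^{N-1} ⟪∇H(∇u), ∇φ⟫ = ∫_U g φ` for all test functions `φ`. -/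
def IsWeakSolution (N : ℕ) (H : Euc N → ℝ) (U : Set (Euc N)) (u g : Euc N → ℝ) : Prop :=
  ∀ φ : Euc N → ℝ, ContDiff ℝ (⊤ : ℕ∞) φ → HasCompactSupport φ → tsupport φ ⊆ U →
    (∫ x in U, H (gradient u x) ^ (N - 1) * ⟪gradient H (gradient u x), gradient φ x⟫)
      = ∫ x in U, g x * φ x

/-- `C_p`, the infimum of `∫_Ω H(∇u)^N` over test functions normalized in `L^{p+1}`. -/
def energyInf (N : ℕ) (H : Euc N → ℝ) (Ω : Set (Euc N)) (p : ℝ) : ℝ :=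
  sInf {c : ℝ | ∃ u : Euc N → ℝ, ContDiff ℝ (⊤ : ℕ∞) u ∧ HasCompactSupport u ∧
    tsupport u ⊆ Ω ∧ (∫ x in Ω, |u x| ^ (p + 1)) = 1 ∧
    c = ∫ x in Ω, H (gradient u x) ^ N}

/-- A least energy solution of the Finsler Lane–Emden problem on `Ω` with exponent `p`. -/
def IsLeastEnergySolution (N : ℕ) (H : Euc N → ℝ) (Ω : Set (Euc N)) (p : ℝ)
    (u : Euc N → ℝ) : Prop :=
  ContDiffOn ℝ 1 u (closure Ω) ∧
  (∀ x ∈ Ω, 0 < u x) ∧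
  (∀ x ∈ frontier Ω, u x = 0) ∧
  IsWeakSolution N H Ω u (fun x => u x ^ p) ∧
  (∫ x in Ω, H (gradient u x) ^ N)
    = energyInf N H Ω p * (∫ x in Ω, u x ^ (p + 1)) ^ ((N : ℝ) / (p + 1))

/-- The blow-up set of a sequence of functions `v n` on `Ω`. -/
def BlowUpSet {N : ℕ} (Ω : Set (Euc N)) (v : ℕ → Euc N → ℝ) : Set (Euc N) :=
  {x | x ∈ closure Ω ∧ ∃ σ : ℕ → ℕ, StrictMono σ ∧ ∃ xs : ℕ → Euc N,
    (∀ n, xs n ∈ Ω) ∧ Tendsto xs atTop (𝓝 x) ∧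
    Tendsto (fun n => v (σ n) (xs n)) atTop atTop}

section FinslerNorm

variable {N : ℕ} {H : Euc N → ℝ}

lemma FinslerRegular.continuous (hN : N ≠ 0) (hnorm : IsFinslerNorm N H)
    (hreg : FinslerRegular N H) : Continuous H := by
  have h : Continuous fun ξ => (H ξ ^ N) ^ ((N : ℝ)⁻¹) :=
    hreg.2.1.continuous.rpow_const fun _ => Or.inr (by positivity)
  simpa only [Real.pow_rpow_inv_natCast (hnorm.2.1 _) hN] using h

lemma IsFinslerNorm.pos (hnorm : IsFinslerNorm N H) {ξ : Euc N} (hξ : ξ ≠ 0) : 0 < H ξ :=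
  lt_of_le_of_ne (hnorm.2.1 ξ) fun h => hξ ((hnorm.2.2.1 ξ).1 h.symm)

lemma IsFinslerNorm.neg (hnorm : IsFinslerNorm N H) (ξ : Euc N) : H (-ξ) = H ξ := by
  simpa using hnorm.2.2.2 (-1) ξ

lemma IsFinslerNorm.exists_bounds (hN : N ≠ 0) (hnorm : IsFinslerNorm N H) (hc : Continuous H) :
    ∃ m M : ℝ, 0 < m ∧ 0 < M ∧ ∀ ξ, m * ‖ξ‖ ≤ H ξ ∧ H ξ ≤ M * ‖ξ‖ := by
  have : Nonempty (Fin N) := ⟨⟨0, Nat.pos_of_ne_zero hN⟩⟩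
  have : Nontrivial (Euc N) := inferInstance
  have hS : IsCompact (Metric.sphere (0 : Euc N) 1) := isCompact_sphere _ _
  have hne : (Metric.sphere (0 : Euc N) 1).Nonempty := NormedSpace.sphere_nonempty.2 zero_le_one
  obtain ⟨a, ha, hamin⟩ := hS.exists_isMinOn hne hc.continuousOn
  obtain ⟨b, hb, hbmax⟩ := hS.exists_isMaxOn hne hc.continuousOn
  have hsphere : ∀ z ∈ Metric.sphere (0 : Euc N) 1, z ≠ 0 := by
    rintro z hz rfl
    simp at hz
  refine ⟨H a, H b, hnorm.pos (hsphere a ha), hnorm.pos (hsphere b hb), fun ξ => ?_⟩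
  rcases eq_or_ne ξ 0 with rfl | hξ
  · simp [(hnorm.2.2.1 0).2 rfl]
  have hξ' : 0 < ‖ξ‖ := norm_pos_iff.2 hξ
  have hmem : ‖ξ‖⁻¹ • ξ ∈ Metric.sphere (0 : Euc N) 1 := by
    simp [norm_smul, hξ'.ne']
  have hHξ : H ξ = H (‖ξ‖⁻¹ • ξ) * ‖ξ‖ := by
    rw [hnorm.2.2.2, abs_of_pos (inv_pos.2 hξ')]
    field_simp
  rw [hHξ]
  exact ⟨mul_le_mul_of_nonneg_right (hamin hmem) hξ'.le,
    mul_le_mul_of_nonneg_right (hbmax hmem) hξ'.le⟩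

lemma dualNorm_bddAbove {m : ℝ} (hm : 0 < m) (hmH : ∀ ξ, m * ‖ξ‖ ≤ H ξ) (x : Euc N) :
    ‖x‖ / m ∈ upperBounds {r : ℝ | ∃ ξ : Euc N, ξ ≠ 0 ∧ r = ⟪x, ξ⟫ / H ξ} := by
  rintro r ⟨ξ, hξ, rfl⟩
  have hξ' : 0 < ‖ξ‖ := norm_pos_iff.2 hξ
  have hH : 0 < H ξ := (mul_pos hm hξ').trans_le (hmH ξ)
  rw [div_le_div_iff₀ hH hm]
  calc ⟪x, ξ⟫ * m ≤ ‖x‖ * ‖ξ‖ * m := by gcongr; exact real_inner_le_norm x ξ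
    _ = ‖x‖ * (m * ‖ξ‖) := by ring
    _ ≤ ‖x‖ * H ξ := by gcongr; exact hmH ξ

lemma dualNorm_nonempty (hN : N ≠ 0) (x : Euc N) :
    {r : ℝ | ∃ ξ : Euc N, ξ ≠ 0 ∧ r = ⟪x, ξ⟫ / H ξ}.Nonempty := by
  have : Nonempty (Fin N) := ⟨⟨0, Nat.pos_of_ne_zero hN⟩⟩
  obtain ⟨ξ, hξ⟩ := exists_ne (0 : Euc N)
  exact ⟨_, ξ, hξ, rfl⟩

/-- The properties of the dual norm used in the potential estimates. -/
structure IsGauge (N : ℕ) (h : Euc N → ℝ) : Prop where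
  continuous : Continuous h
  pos : ∀ x, x ≠ 0 → 0 < h x
  smul : ∀ t : ℝ, 0 < t → ∀ x, h (t • x) = t * h x
  le : ∃ C, 0 < C ∧ ∀ x, h x ≤ C * ‖x‖
  ge : ∃ C, 0 < C ∧ ∀ x, ‖x‖ ≤ C * h x

lemma inner_le_dualNorm_mul (hH0 : H 0 = 0) {m : ℝ} (hm : 0 < m) (hmH : ∀ ξ, m * ‖ξ‖ ≤ H ξ) (x ξ : Euc N) :
    ⟪x, ξ⟫ ≤ dualNorm H x * H ξ := by
  rcases eq_or_ne ξ 0 with rfl | hξ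
  · simp [hH0]
  have hH : 0 < H ξ := (mul_pos hm (norm_pos_iff.2 hξ)).trans_le (hmH ξ)
  rw [← div_le_iff₀ hH]
  exact le_csSup ⟨_, dualNorm_bddAbove hm hmH x⟩ ⟨ξ, hξ, rfl⟩

lemma isGauge_dualNorm (hN : N ≠ 0) (hnorm : IsFinslerNorm N H) (hc : Continuous H) :
    IsGauge N (dualNorm H) := by
  obtain ⟨m, M, hm, hM, hb⟩ := hnorm.exists_bounds hN hc
  have hmH := fun ξ => (hb ξ).1
  have hH0 : H 0 = 0 := (hnorm.2.2.1 0).2 rfl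
  have hle : ∀ x, dualNorm H x ≤ ‖x‖ / m := fun x =>
    csSup_le (dualNorm_nonempty hN x) (dualNorm_bddAbove hm hmH x)
  have hge : ∀ x, ‖x‖ ≤ M * dualNorm H x := by
    intro x
    rcases eq_or_ne x 0 with rfl | hx
    · have : 0 ≤ dualNorm H (0 : Euc N) := by
        apply Real.sSup_nonneg
        rintro r ⟨ξ, -, rfl⟩
        simp
      simpa using mul_nonneg hM.le this
    have hx' : 0 < ‖x‖ := norm_pos_iff.2 hx
    have h0 : ‖x‖ * ‖x‖ ≤ dualNorm H x * H x := by
      rw [← real_inner_self_eq_norm_mul_norm]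
      exact inner_le_dualNorm_mul hH0 hm hmH x x
    have hpos : 0 ≤ dualNorm H x := by
      by_contra! hneg
      nlinarith [hnorm.pos hx, mul_pos hx' hx']
    have h1 : dualNorm H x * H x ≤ dualNorm H x * (M * ‖x‖) := by
      gcongr; exact (hb x).2
    have : ‖x‖ * ‖x‖ ≤ (M * dualNorm H x) * ‖x‖ := by linarith
    exact le_of_mul_le_mul_right this hx'
  have hadd : ∀ x y, dualNorm H (x + y) ≤ dualNorm H x + dualNorm H y := by
    intro x y
    refine csSup_le (dualNorm_nonempty hN _) ?_
    rintro r ⟨ξ, hξ, rfl⟩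
    have hH := hnorm.pos hξ
    rw [div_le_iff₀ hH, inner_add_left, add_mul]
    exact add_le_add (inner_le_dualNorm_mul hH0 hm hmH x ξ) (inner_le_dualNorm_mul hH0 hm hmH y ξ)
  have hsmul_le : ∀ t : ℝ, 0 < t → ∀ x, dualNorm H (t • x) ≤ t * dualNorm H x := by
    intro t ht x
    refine csSup_le (dualNorm_nonempty hN _) ?_
    rintro r ⟨ξ, hξ, rfl⟩
    have hH := hnorm.pos hξ
    rw [div_le_iff₀ hH, real_inner_smul_left, mul_assoc]
    gcongr
    exact inner_le_dualNorm_mul hH0 hm hmH x ξ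
  refine ⟨?_, ?_, ?_, ⟨m⁻¹, inv_pos.2 hm, fun x => ?_⟩, ⟨M, hM, hge⟩⟩
  · refine (LipschitzWith.of_dist_le_mul (K := ⟨m⁻¹, (inv_pos.2 hm).le⟩) fun x y => ?_).continuous
    rw [Real.dist_eq, dist_eq_norm, abs_sub_le_iff]
    have h1 := hadd (x - y) y
    have h2 := hadd (y - x) x
    rw [sub_add_cancel] at h1 h2
    have h3 := hle (x - y)
    have h4 := hle (y - x)
    rw [norm_sub_rev] at h4
    rw [div_eq_inv_mul] at h3 h4
    constructor
    · show _ ≤ m⁻¹ * _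
      linarith
    · show _ ≤ m⁻¹ * _
      linarith
  · intro x hx
    exact pos_of_mul_pos_right ((norm_pos_iff.2 hx).trans_le (hge x)) hM.le
  · intro t ht x
    refine le_antisymm (hsmul_le t ht x) ?_
    have := hsmul_le t⁻¹ (inv_pos.2 ht) (t • x)
    rw [smul_smul, inv_mul_cancel₀ ht.ne', one_smul] at this
    rwa [le_inv_mul_iff₀ ht] at this
  · rw [← div_eq_inv_mul]
    exact hle x

end FinslerNorm

section Gauge

variable {N : ℕ} {h : Euc N → ℝ}

lemma lintegral_comp_smul_euc {f : Euc N → ENNReal} (hf : Measurable f) {s : ℝ} (hs : 0 < s) :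
    ∫⁻ z, f (s • z) = ENNReal.ofReal ((s ^ N)⁻¹) * ∫⁻ y, f y := by
  rw [← lintegral_map hf (measurable_const_smul s), Measure.map_addHaar_smul volume hs.ne',
    lintegral_smul_measure, finrank_euclideanSpace_fin, abs_of_pos (by positivity), smul_eq_mul]

lemma lintegral_Ioi_mul_rpow {c p : ℝ} (hc : 0 < c) (hp : 0 < p) :
    ∫⁻ s in Ioi c, ENNReal.ofReal (p * s ^ (-p - 1)) = ENNReal.ofReal (c ^ (-p)) := by
  rw [← ofReal_integral_eq_lintegral_ofReal]
  · rw [integral_const_mul, integral_Ioi_rpow_of_lt (by linarith) hc]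
    congr 1
    rw [sub_add_cancel]
    field_simp
  · exact (integrableOn_Ioi_rpow_of_lt (by linarith) hc).const_mul p
  · filter_upwards [ae_restrict_mem measurableSet_Ioi] with s hs
    have : 0 < s := hc.trans hs
    show 0 ≤ _
    positivity

open scoped Pointwise in
lemma IsGauge.volume_lt (hh : IsGauge N h) {s : ℝ} (hs : 0 < s) :
    volume {x | h x < s} = ENNReal.ofReal (s ^ N) * volume {x | h x < 1} := by
  have : {x | h x < s} = s • {x | h x < 1} := by
    ext x
    rw [Set.mem_smul_set_iff_inv_smul_mem₀ hs.ne', mem_ofPred_eq, mem_ofPred_eq,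
      hh.smul _ (inv_pos.2 hs), inv_mul_lt_one₀ hs]
  rw [this, Measure.addHaar_smul, finrank_euclideanSpace_fin, abs_of_pos (by positivity)]

lemma IsGauge.map_zero (hh : IsGauge N h) : h 0 = 0 := by
  have := hh.smul 2 two_pos 0
  rw [smul_zero] at this
  linarith

lemma IsGauge.nonneg (hh : IsGauge N h) (x : Euc N) : 0 ≤ h x := by
  rcases eq_or_ne x 0 with rfl | hx
  · exact hh.map_zero.ge
  · exact (hh.pos x hx).le

lemma IsGauge.volume_pos (hh : IsGauge N h) : 0 < volume {x | h x < 1} := by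
  refine (isOpen_lt hh.continuous continuous_const).measure_pos _ ⟨0, ?_⟩
  simp [hh.map_zero]

lemma IsGauge.volume_lt_top (hh : IsGauge N h) : volume {x | h x < 1} < ⊤ := by
  obtain ⟨C, hC, hCh⟩ := hh.ge
  refine (measure_mono fun x hx => ?_).trans_lt
    (measure_ball_lt_top (μ := volume) (x := (0 : Euc N)) (r := C))
  rw [mem_ball_zero_iff]
  calc ‖x‖ ≤ C * h x := hCh x
    _ < C * 1 := by gcongr; exact hx
    _ = C := mul_one C

lemma IsGauge.measurableSet_sublevel (hh : IsGauge N h) (s : ℝ) : MeasurableSet {x | h x < s} :=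
  (isOpen_lt hh.continuous continuous_const).measurableSet

lemma IsGauge.ae_pos (hN : N ≠ 0) (hh : IsGauge N h) : ∀ᵐ x, 0 < h x := by
  have : Nonempty (Fin N) := ⟨⟨0, Nat.pos_of_ne_zero hN⟩⟩
  filter_upwards [compl_mem_ae_iff.2 (measure_singleton (μ := volume) (0 : Euc N))] with x hx
  exact hh.pos x hx

lemma IsGauge.lintegral_mul_rpow (hN : N ≠ 0) (hh : IsGauge N h) {g : Euc N → ENNReal}
    (hg : Measurable g) {p : ℝ} (hp : 0 < p) :
    ∫⁻ y, g y * ENNReal.ofReal (h y ^ (-p)) =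
      ∫⁻ s in Ioi (0 : ℝ), ENNReal.ofReal (p * s ^ (-p - 1)) *
        ∫⁻ y, {y | h y < s}.indicator g y := by
  have hm : Measurable h := hh.continuous.measurable
  have hset : MeasurableSet {q : ℝ × Euc N | h q.2 < q.1} :=
    measurableSet_lt (hm.comp measurable_snd) measurable_fst
  have hmeas : Measurable (Function.uncurry fun (s : ℝ) (y : Euc N) =>
      ENNReal.ofReal (p * s ^ (-p - 1)) * {y | h y < s}.indicator g y) := by
    refine Measurable.mul (by fun_prop) ?_
    have : (fun q : ℝ × Euc N => {y | h y < q.1}.indicator g q.2) =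
        {q : ℝ × Euc N | h q.2 < q.1}.indicator fun q => g q.2 := by
      ext q; simp [indicator_apply]
    rw [this]
    exact (hg.comp measurable_snd).indicator hset
  have hind : ∀ s : ℝ, Measurable ({y | h y < s}.indicator g) := fun s =>
    hg.indicator (hh.measurableSet_sublevel s)
  simp_rw [← lintegral_const_mul _ (hind _)]
  rw [lintegral_lintegral_swap hmeas.aemeasurable]
  refine lintegral_congr_ae ?_
  filter_upwards [hh.ae_pos hN] with y hy
  rw [← lintegral_Ioi_mul_rpow hy hp, ← lintegral_const_mul _ (by fun_prop),
    ← lintegral_indicator measurableSet_Ioi, ← lintegral_indicator measurableSet_Ioi]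
  refine lintegral_congr fun s => ?_
  by_cases hs : h y < s
  · simp [indicator_apply, hs, hy.trans hs, mul_comm]
  · simp [indicator_apply, hs]

lemma IsGauge.setLIntegral_rpow_le (hN : N ≠ 0) (hh : IsGauge N h) {p ρ R : ℝ} (hp : 0 < p)
    (hR : 0 < R) :
    ∫⁻ y in {y | ρ ≤ h y ∧ h y < R}, ENNReal.ofReal (h y ^ (-p)) ≤
      volume {x | h x < 1} * (∫⁻ s in Ioc ρ R, ENNReal.ofReal (p * s ^ (-p - 1 + N))) +
        volume {x | h x < 1} * ENNReal.ofReal (R ^ (-p + N)) := by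
  have hm : Measurable h := hh.continuous.measurable
  set A := {y | ρ ≤ h y ∧ h y < R} with hA
  have hAm : MeasurableSet A := (measurableSet_le measurable_const hm).inter (hh.measurableSet_sublevel R)
  set κ := volume {x | h x < 1} with hκ
  have h1 : ∫⁻ y in A, ENNReal.ofReal (h y ^ (-p)) =
      ∫⁻ y, A.indicator 1 y * ENNReal.ofReal (h y ^ (-p)) := by
    rw [← lintegral_indicator hAm]
    refine lintegral_congr fun y => ?_
    by_cases hy : y ∈ A <;> simp [hy]
  have h2 : ∀ s, ∫⁻ y, {y | h y < s}.indicator (A.indicator 1) y =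
      volume ({y | h y < s} ∩ A) := by
    intro s
    rw [indicator_indicator, lintegral_indicator_one ((hh.measurableSet_sublevel s).inter hAm)]
  rw [h1, hh.lintegral_mul_rpow hN (measurable_one.indicator hAm) hp]
  simp_rw [h2]
  calc ∫⁻ s in Ioi (0 : ℝ), ENNReal.ofReal (p * s ^ (-p - 1)) * volume ({y | h y < s} ∩ A)
      ≤ ∫⁻ s, ((Ioc ρ R).indicator (fun s => κ * ENNReal.ofReal (p * s ^ (-p - 1 + N))) s +
          (Ioi R).indicator
            (fun s => κ * ENNReal.ofReal (R ^ N) * ENNReal.ofReal (p * s ^ (-p - 1))) s) := by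
        rw [← lintegral_indicator measurableSet_Ioi]
        refine lintegral_mono fun s => ?_
        by_cases hs0 : s ∈ Ioi (0 : ℝ)
        · have hs0' : 0 < s := hs0
          rw [indicator_of_mem hs0]
          rcases le_or_gt s ρ with hsρ | hsρ
          · have : {y | h y < s} ∩ A = ∅ := by
              ext y
              simp only [hA, mem_inter_iff, mem_ofPred_eq, mem_empty_iff_false, iff_false]
              intro hy
              linarith [hy.1, hy.2.1]
            simp [this]
          rcases le_or_gt s R with hsR | hsR
          · rw [indicator_of_mem (show s ∈ Ioc ρ R from ⟨hsρ, hsR⟩)]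
            refine le_trans ?_ le_self_add
            calc _ ≤ ENNReal.ofReal (p * s ^ (-p - 1)) * volume {y | h y < s} := by
                  gcongr; exact inter_subset_left
              _ = κ * ENNReal.ofReal (p * s ^ (-p - 1 + N)) := by
                  rw [hh.volume_lt hs0', ← mul_assoc, ← ENNReal.ofReal_mul (by positivity),
                    mul_comm, Real.rpow_add hs0', Real.rpow_natCast, mul_assoc]
          · rw [indicator_of_mem (show s ∈ Ioi R from hsR)]
            refine le_trans ?_ le_add_self
            calc _ ≤ ENNReal.ofReal (p * s ^ (-p - 1)) * volume {y | h y < R} := by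
                  gcongr; exact fun y hy => hy.2.2
              _ = _ := by
                  rw [hh.volume_lt hR]; ring
        · simp [indicator_of_notMem hs0]
    _ = κ * (∫⁻ s in Ioc ρ R, ENNReal.ofReal (p * s ^ (-p - 1 + N))) +
        κ * ENNReal.ofReal (R ^ (-p + N)) := by
        rw [lintegral_add_left (Measurable.indicator (by fun_prop) measurableSet_Ioc),
          lintegral_indicator measurableSet_Ioc, lintegral_indicator measurableSet_Ioi,
          lintegral_const_mul _ (by fun_prop), lintegral_const_mul _ (by fun_prop),
          lintegral_Ioi_mul_rpow hR hp, mul_assoc, ← ENNReal.ofReal_mul (by positivity),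
          Real.rpow_add hR, Real.rpow_natCast, mul_comm (R ^ N)]

lemma IsGauge.setLIntegral_rpow_dim_le (hN : N ≠ 0) (hh : IsGauge N h) {ρ R : ℝ}
    (hρ : 0 < ρ) (hρR : ρ ≤ R) :
    ∫⁻ y in {y | ρ ≤ h y ∧ h y < R}, ENNReal.ofReal (h y ^ (-(N : ℝ))) ≤
      volume {x | h x < 1} * ENNReal.ofReal (N * Real.log (R / ρ) + 1) := by
  have hR : 0 < R := hρ.trans_le hρR
  have hlog : 0 ≤ Real.log (R / ρ) := Real.log_nonneg ((one_le_div hρ).2 hρR)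
  refine (hh.setLIntegral_rpow_le hN (by positivity) hR).trans_eq ?_
  rw [← mul_add, neg_add_cancel, Real.rpow_zero,
    ENNReal.ofReal_add (by positivity) zero_le_one]
  congr 2
  rw [← integral_inv_of_pos hρ hR, intervalIntegral.integral_of_le hρR, ← integral_const_mul,
    ofReal_integral_eq_lintegral_ofReal]
  · refine setLIntegral_congr_fun measurableSet_Ioc fun s hs => ?_
    rw [show -(N : ℝ) - 1 + N = -1 by ring, Real.rpow_neg_one]
  · have := (intervalIntegral.intervalIntegrable_inv (μ := volume) (f := fun x : ℝ => x) (a := ρ)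
      (b := R) (fun x hx => ?_) continuousOn_id)
    · exact ((intervalIntegrable_iff_integrableOn_Ioc_of_le hρR).1 this).const_mul _
    · rw [uIcc_of_le hρR] at hx
      exact (hρ.trans_le hx.1).ne'
  · filter_upwards [ae_restrict_mem measurableSet_Ioc] with s hs
    have : 0 < s := hρ.trans hs.1
    show 0 ≤ _
    positivity

lemma IsGauge.setLIntegral_rpow_lt_top (hN : N ≠ 0) (hh : IsGauge N h) {p R : ℝ} (hp : 0 < p)
    (hpN : p < N) (hR : 0 < R) :
    ∫⁻ y in {y | h y < R}, ENNReal.ofReal (h y ^ (-p)) < ⊤ := by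
  have hset : {y | h y < R} = {y | 0 ≤ h y ∧ h y < R} := by
    ext y; simp [hh.nonneg y]
  rw [hset]
  refine (hh.setLIntegral_rpow_le hN hp hR).trans_lt ?_
  have hint : ∫⁻ s in Ioc 0 R, ENNReal.ofReal (p * s ^ (-p - 1 + N)) < ⊤ := by
    refine Integrable.lintegral_lt_top (Integrable.const_mul ?_ p)
    exact (intervalIntegrable_iff_integrableOn_Ioc_of_le hR.le).1
      (intervalIntegral.intervalIntegrable_rpow' (by linarith))
  exact ENNReal.add_lt_top.2 ⟨ENNReal.mul_lt_top hh.volume_lt_top hint,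
    ENNReal.mul_lt_top hh.volume_lt_top ENNReal.ofReal_lt_top⟩

end Gauge

section Potential

variable {N : ℕ} {h : Euc N → ℝ}

lemma enorm_le_lintegral_ray {u : Euc N → ℝ} (hu : ContDiff ℝ 1 u) (hc : HasCompactSupport u)
    {G : Euc N → ℝ} (hG : ∀ x z, |⟪gradient u x, z⟫| ≤ h z * G x) (x : Euc N) {z : Euc N}
    (hz : z ≠ 0) (hhz : 0 ≤ h z) :
    ‖u x‖ₑ ≤ ∫⁻ s in Ioi (0 : ℝ), ENNReal.ofReal (G (x + s • z)) * ENNReal.ofReal (h z) := by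
  have hline : Topology.IsClosedEmbedding fun s : ℝ => x + s • z :=
    (Homeomorph.addLeft x).isClosedEmbedding.comp (isClosedEmbedding_smul_left hz)
  have hline' : ∀ s : ℝ, HasDerivAt (fun s : ℝ => x + s • z) z s := fun s => by
    simpa using ((hasDerivAt_id s).smul_const z).const_add x
  have hg : ContDiff ℝ 1 fun s : ℝ => u (x + s • z) := by fun_prop
  have hgc : HasCompactSupport fun s : ℝ => u (x + s • z) := hc.comp_isClosedEmbedding hline
  have hderiv : ∀ s : ℝ, deriv (fun s : ℝ => u (x + s • z)) s = ⟪gradient u (x + s • z), z⟫ := by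
    intro s
    rw [inner_gradient_left]
    exact (((hu.differentiable one_ne_zero) (x + s • z)).hasFDerivAt.comp_hasDerivAt s
      (hline' s)).deriv
  have hint := hgc.integral_Ioi_deriv_eq hg 0
  simp only [zero_smul, add_zero] at hint
  rw [← enorm_neg, ← hint]
  refine (enorm_integral_le_lintegral_enorm _).trans (lintegral_mono fun s => ?_)
  rw [hderiv, Real.enorm_eq_ofReal_abs, mul_comm, ← ENNReal.ofReal_mul hhz]
  exact ENNReal.ofReal_le_ofReal (hG _ _)

lemma IsGauge.enorm_le_potential (hN : N ≠ 0) (hh : IsGauge N h) {u : Euc N → ℝ}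
    (hu : ContDiff ℝ 1 u) (hc : HasCompactSupport u) {G : Euc N → ℝ} (hGm : Measurable G)
    (hG : ∀ x z, |⟪gradient u x, z⟫| ≤ h z * G x) (x : Euc N) :
    N * volume {y | h y < 1} * ‖u x‖ₑ ≤
      ∫⁻ y, ENNReal.ofReal (G (x + y)) * ENNReal.ofReal (h y ^ (1 - N : ℝ)) := by
  have hm : Measurable h := hh.continuous.measurable
  have hNpos : (0 : ℝ) < N := by positivity
  set W := {y | h y < 1} with hW
  set g : Euc N → ENNReal := fun y => ENNReal.ofReal (G (x + y)) * ENNReal.ofReal (h y) with hg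
  have hgm : Measurable g := by fun_prop
  have hgind : ∀ s : ℝ, Measurable ({y | h y < s}.indicator g) := fun s =>
    hgm.indicator (hh.measurableSet_sublevel s)
  have hray : volume W * ‖u x‖ₑ ≤ ∫⁻ z in W, ∫⁻ s in Ioi (0 : ℝ),
      ENNReal.ofReal (G (x + s • z)) * ENNReal.ofReal (h z) := by
    rw [mul_comm, ← setLIntegral_const]
    refine lintegral_mono_ae (ae_restrict_of_ae ?_)
    filter_upwards [hh.ae_pos hN] with z hz
    refine enorm_le_lintegral_ray hu hc hG x ?_ hz.le
    rintro rfl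
    exact hz.ne' hh.map_zero
  have hscale : ∀ s ∈ Ioi (0 : ℝ),
      ∫⁻ z in W, ENNReal.ofReal (G (x + s • z)) * ENNReal.ofReal (h z) =
        ENNReal.ofReal (s ^ (-(N : ℝ) - 1)) * ∫⁻ y, {y | h y < s}.indicator g y := by
    intro s hs
    have hs' : 0 < s := hs
    rw [← lintegral_indicator (hh.measurableSet_sublevel 1)]
    have hpt : ∀ z, W.indicator
        (fun z => ENNReal.ofReal (G (x + s • z)) * ENNReal.ofReal (h z)) z =
        ENNReal.ofReal s⁻¹ * {y | h y < s}.indicator g (s • z) := by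
      intro z
      have hmem : s • z ∈ {y | h y < s} ↔ z ∈ W := by
        rw [mem_ofPred_eq, hh.smul s hs', hW, mem_ofPred_eq, mul_lt_iff_lt_one_right hs']
      by_cases hz : z ∈ W
      · rw [indicator_of_mem hz, indicator_of_mem (hmem.2 hz), hg]
        simp only
        rw [hh.smul s hs', ENNReal.ofReal_mul hs'.le, mul_left_comm, ← mul_assoc (ENNReal.ofReal s⁻¹),
          ← ENNReal.ofReal_mul (inv_nonneg.2 hs'.le), inv_mul_cancel₀ hs'.ne', ENNReal.ofReal_one, one_mul]
      · rw [indicator_of_notMem hz, indicator_of_notMem (mt hmem.1 hz), mul_zero]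
    rw [lintegral_congr hpt]
    have hcomp : Measurable fun z : Euc N => {y | h y < s}.indicator g (s • z) :=
      (hgind s).comp (measurable_const_smul s)
    rw [lintegral_const_mul _ hcomp,
      lintegral_comp_smul_euc (hgind s) hs', ← mul_assoc, ← ENNReal.ofReal_mul (by positivity)]
    congr 2
    rw [Real.rpow_sub hs', Real.rpow_neg hs'.le, Real.rpow_natCast, Real.rpow_one]
    field_simp
  rw [lintegral_lintegral_swap (by
      refine Measurable.aemeasurable ?_
      unfold Function.uncurry
      fun_prop), setLIntegral_congr_fun measurableSet_Ioi hscale] at hray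
  calc N * volume W * ‖u x‖ₑ
      ≤ N * ∫⁻ s in Ioi (0 : ℝ), ENNReal.ofReal (s ^ (-(N : ℝ) - 1)) *
          ∫⁻ y, {y | h y < s}.indicator g y := by
        rw [mul_assoc]; gcongr
    _ ≤ ∫⁻ s in Ioi (0 : ℝ), N * (ENNReal.ofReal (s ^ (-(N : ℝ) - 1)) *
          ∫⁻ y, {y | h y < s}.indicator g y) := lintegral_const_mul_le _ _
    _ = ∫⁻ s in Ioi (0 : ℝ), ENNReal.ofReal (N * s ^ (-(N : ℝ) - 1)) *
          ∫⁻ y, {y | h y < s}.indicator g y := by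
        refine lintegral_congr fun s => ?_
        rw [ENNReal.ofReal_mul hNpos.le, ENNReal.ofReal_natCast, mul_assoc]
    _ = ∫⁻ y, g y * ENNReal.ofReal (h y ^ (-(N : ℝ))) :=
        (hh.lintegral_mul_rpow hN hgm hNpos).symm
    _ = _ := by
        refine lintegral_congr_ae ?_
        filter_upwards [hh.ae_pos hN] with y hy
        rw [hg]
        simp only
        rw [mul_assoc, ← ENNReal.ofReal_mul hy.le, sub_eq_add_neg, Real.rpow_add hy,
          Real.rpow_one]

lemma lintegral_rpow_average_le {f : Euc N → ENNReal} (hf : Measurable f) (μ : Measure (Euc N))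
    [SFinite μ] {p : ℝ} (hp : 1 < p) :
    ∫⁻ x, (∫⁻ y, f (x + y) ∂μ) ^ p ≤ μ univ ^ p * ∫⁻ x, f x ^ p := by
  have hpq := Real.HolderConjugate.conjExponent hp
  have hp0 : 0 < p := by linarith
  have hpt : ∀ x, (∫⁻ y, f (x + y) ∂μ) ^ p ≤ μ univ ^ (p - 1) * ∫⁻ y, f (x + y) ^ p ∂μ := by
    intro x
    have h1 := ENNReal.lintegral_mul_le_Lp_mul_Lq μ hpq (f := fun y => f (x + y)) (g := 1)
      (by fun_prop) (by fun_prop)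
    simp only [mul_one, Pi.one_apply, ENNReal.one_rpow, lintegral_one] at h1
    calc _ ≤ _ := ENNReal.rpow_le_rpow h1 hp0.le
      _ = _ := by
        rw [ENNReal.mul_rpow_of_nonneg _ _ hp0.le, ← ENNReal.rpow_mul, ← ENNReal.rpow_mul,
          one_div, inv_mul_cancel₀ hp0.ne', ENNReal.rpow_one, mul_comm]
        congr 2
        rw [Real.conjExponent]
        field_simp
  calc _ ≤ ∫⁻ x, μ univ ^ (p - 1) * ∫⁻ y, f (x + y) ^ p ∂μ := lintegral_mono hpt
    _ = μ univ ^ (p - 1) * ∫⁻ y, (∫⁻ x, f (x + y) ^ p) ∂μ := by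
        rw [lintegral_const_mul _ (by fun_prop), lintegral_lintegral_swap (by
          unfold Function.uncurry; fun_prop)]
    _ = _ := by
        rw [lintegral_congr fun y =>
            lintegral_add_right_eq_self (μ := volume) (fun x => f x ^ p) y, lintegral_const,
          mul_left_comm, mul_comm]
        conv_rhs => rw [show p = (p - 1) + 1 by ring,
          ENNReal.rpow_add_of_nonneg _ _ (by linarith) zero_le_one, ENNReal.rpow_one]
        ring_nf

end Potential

section LogEstimate

variable {N : ℕ} {h : Euc N → ℝ}

lemma IsGauge.potential_le_log (hN : 2 ≤ N) (hh : IsGauge N h) {f : Euc N → ENNReal}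
    (hf : Measurable f) {F a R : ℝ} (hF : 0 < F) (ha : 0 < a) (hR : 0 < R)
    (hfF : ∫⁻ x, f x ^ (N : ℝ) ≤ ENNReal.ofReal F ^ (N : ℝ)) (x : Euc N)
    (hsupp : ∀ y, f (x + y) ≠ 0 → h y < R)
    (hV : ∫⁻ y in {y | h y < R}, f (x + y) * ENNReal.ofReal (h y ^ (1 - N - a)) < ⊤) :
    ∫⁻ y, f (x + y) * ENNReal.ofReal (h y ^ (1 - N : ℝ)) ≤
      ENNReal.ofReal (F * (((volume {y | h y < 1}).toReal * (N / a * Real.log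
        (1 + (∫⁻ y in {y | h y < R}, f (x + y) *
          ENNReal.ofReal (h y ^ (1 - N - a))).toReal / F) + 1)) ^ (((N : ℝ) - 1) / N) +
          R ^ a)) := by
  have hm : Measurable h := hh.continuous.measurable
  have hN1 : (1 : ℝ) < N := by exact_mod_cast hN
  have hN0 : N ≠ 0 := by omega
  set V := ∫⁻ y in {y | h y < R}, f (x + y) * ENNReal.ofReal (h y ^ (1 - N - a)) with hVdef
  set v := V.toReal with hv
  have hv0 : 0 ≤ v := ENNReal.toReal_nonneg
  set κ := (volume {y | h y < 1}).toReal with hκ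
  have hκ0 : 0 ≤ κ := ENNReal.toReal_nonneg
  have hκ' : volume {y | h y < 1} = ENNReal.ofReal κ :=
    (ENNReal.ofReal_toReal hh.volume_lt_top.ne).symm
  have hw0 : 1 ≤ 1 + v / F := by
    have : 0 ≤ v / F := by positivity
    linarith
  have hwpos : 0 < 1 + v / F := by linarith
  set ρ := R * (1 + v / F) ^ (-a⁻¹) with hρdef
  have hρ : 0 < ρ := by positivity
  have hρR : ρ ≤ R := by
    refine mul_le_of_le_one_right hR.le (Real.rpow_le_one_of_one_le_of_nonpos hw0 ?_)
    simpa using ha.le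
  have hlog : Real.log (R / ρ) = a⁻¹ * Real.log (1 + v / F) := by
    rw [hρdef, div_mul_cancel_left₀ hR.ne', ← Real.rpow_neg hwpos.le, neg_neg,
      Real.log_rpow hwpos]
  have hρa : ρ ^ a = R ^ a * (1 + v / F)⁻¹ := by
    rw [hρdef, Real.mul_rpow hR.le (by positivity), ← Real.rpow_mul hwpos.le]
    rw [neg_mul, inv_mul_cancel₀ ha.ne', Real.rpow_neg_one]
  set A := {y | ρ ≤ h y ∧ h y < R} with hA
  have hAm : MeasurableSet A :=
    (measurableSet_le measurable_const hm).inter (hh.measurableSet_sublevel R)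
  set B := {y | h y < ρ} with hB
  have hBm : MeasurableSet B := hh.measurableSet_sublevel ρ
  have hsplit : ∫⁻ y, f (x + y) * ENNReal.ofReal (h y ^ (1 - N : ℝ)) ≤
      (∫⁻ y in A, f (x + y) * ENNReal.ofReal (h y ^ (1 - N : ℝ))) +
        ∫⁻ y in B, f (x + y) * ENNReal.ofReal (h y ^ (1 - N : ℝ)) := by
    rw [← lintegral_indicator hAm, ← lintegral_indicator hBm,
      ← lintegral_add_left (Measurable.indicator (by fun_prop) hAm)]
    refine lintegral_mono fun y => ?_
    by_cases hy : f (x + y) = 0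
    · simp [hy]
    have hyR := hsupp y hy
    rcases lt_or_ge (h y) ρ with hyρ | hyρ
    · rw [indicator_of_mem (show y ∈ B from hyρ)]
      exact le_add_self
    · rw [indicator_of_mem (show y ∈ A from ⟨hyρ, hyR⟩)]
      exact le_self_add
  have hfar : ∫⁻ y in A, f (x + y) * ENNReal.ofReal (h y ^ (1 - N : ℝ)) ≤
      ENNReal.ofReal (F * (κ * (N / a * Real.log (1 + v / F) + 1)) ^ (((N : ℝ) - 1) / N)) := by
    have hpq := Real.HolderConjugate.conjExponent hN1
    have hq : 1 / Real.conjExponent N = ((N : ℝ) - 1) / N := by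
      rw [Real.conjExponent, one_div_div]
    refine (ENNReal.lintegral_mul_le_Lp_mul_Lq (volume.restrict A) hpq (f := fun y => f (x + y))
      (g := fun y => ENNReal.ofReal (h y ^ (1 - N : ℝ))) (by fun_prop) (by fun_prop)).trans ?_
    rw [hq, ENNReal.ofReal_mul hF.le]
    have hlog0 : 0 ≤ Real.log (1 + v / F) := Real.log_nonneg hw0
    have hq0 : 0 ≤ ((N : ℝ) - 1) / N := div_nonneg (by linarith) (by linarith)
    gcongr
    · calc (∫⁻ y in A, f (x + y) ^ (N : ℝ)) ^ (1 / (N : ℝ))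
          ≤ (∫⁻ y, f (x + y) ^ (N : ℝ)) ^ (1 / (N : ℝ)) := by
            exact ENNReal.rpow_le_rpow (setLIntegral_le_lintegral _ _) (by positivity)
        _ ≤ (ENNReal.ofReal F ^ (N : ℝ)) ^ (1 / (N : ℝ)) := by
            rw [lintegral_add_left_eq_self (μ := volume) (fun y => f y ^ (N : ℝ)) x]
            gcongr
        _ = ENNReal.ofReal F := by
            rw [← ENNReal.rpow_mul, mul_one_div_cancel (by linarith), ENNReal.rpow_one]
    · rw [← ENNReal.ofReal_rpow_of_nonneg (by positivity) hq0]
      gcongr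
      have heq : ∀ y, ENNReal.ofReal (h y ^ (1 - N : ℝ)) ^ Real.conjExponent N =
          ENNReal.ofReal (h y ^ (-(N : ℝ))) := by
        intro y
        rw [ENNReal.ofReal_rpow_of_nonneg (Real.rpow_nonneg (hh.nonneg y) _) hpq.symm.nonneg,
          ← Real.rpow_mul (hh.nonneg y), Real.conjExponent]
        have : (N : ℝ) - 1 ≠ 0 := by linarith
        congr 2
        field_simp
        ring
      simp_rw [heq]
      refine (hh.setLIntegral_rpow_dim_le hN0 hρ hρR).trans_eq ?_
      rw [hκ', ← ENNReal.ofReal_mul hκ0, hlog]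
      congr 3
      ring
  have hnear : ∫⁻ y in B, f (x + y) * ENNReal.ofReal (h y ^ (1 - N : ℝ)) ≤
      ENNReal.ofReal (F * R ^ a) := by
    calc ∫⁻ y in B, f (x + y) * ENNReal.ofReal (h y ^ (1 - N : ℝ))
        ≤ ∫⁻ y in B, ENNReal.ofReal (ρ ^ a) *
            (f (x + y) * ENNReal.ofReal (h y ^ (1 - N - a))) := by
          refine setLIntegral_mono (by fun_prop) fun y hy => ?_
          rw [mul_left_comm, ← ENNReal.ofReal_mul (by positivity)]
          gcongr
          rcases (hh.nonneg y).eq_or_lt with h0 | h0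
          · rw [← h0, Real.zero_rpow (by linarith)]
            positivity
          · calc h y ^ (1 - N : ℝ) = h y ^ a * h y ^ (1 - N - a) := by
                  rw [← Real.rpow_add h0]; congr 1; ring
              _ ≤ _ := by
                  gcongr
                  exact le_of_lt hy
      _ ≤ ENNReal.ofReal (ρ ^ a) * V := by
          rw [lintegral_const_mul _ (by fun_prop)]
          gcongr
          exact lintegral_mono_set fun y (hy : h y < ρ) => hy.trans_le hρR
      _ = ENNReal.ofReal (ρ ^ a * v) := by
          rw [ENNReal.ofReal_mul (by positivity), hv, ENNReal.ofReal_toReal hV.ne]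
      _ ≤ ENNReal.ofReal (F * R ^ a) := by
          apply ENNReal.ofReal_le_ofReal
          rw [hρa]
          have hvF : (1 + v / F)⁻¹ * v ≤ F := by
            rw [inv_mul_le_iff₀ hwpos, add_mul, div_mul_cancel₀ _ hF.ne']
            linarith
          calc R ^ a * (1 + v / F)⁻¹ * v = R ^ a * ((1 + v / F)⁻¹ * v) := by ring
            _ ≤ R ^ a * F := by gcongr
            _ = F * R ^ a := mul_comm _ _
  refine hsplit.trans ((add_le_add hfar hnear).trans_eq ?_)
  have hlog0 : 0 ≤ Real.log (1 + v / F) := Real.log_nonneg hw0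
  rw [← ENNReal.ofReal_add (by positivity) (by positivity), mul_add F]

lemma rpow_le_mul_exp {y q M : ℝ} (hy : 0 ≤ y) (hq : 0 < q) (hM : 0 < M) :
    y ^ q ≤ (q / (M * Real.exp 1)) ^ q * Real.exp (M * y) := by
  have h1 : y ≤ q / (M * Real.exp 1) * Real.exp (M * y / q) := by
    have h2 := Real.add_one_le_exp (M * y / q - 1)
    rw [sub_add_cancel, Real.exp_sub] at h2
    calc y = q / M * (M * y / q) := by field_simp
      _ ≤ q / M * (Real.exp (M * y / q) / Real.exp 1) := by gcongr
      _ = _ := by field_simp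
  calc y ^ q ≤ (q / (M * Real.exp 1) * Real.exp (M * y / q)) ^ q :=
        Real.rpow_le_rpow hy h1 hq.le
    _ = _ := by
        rw [Real.mul_rpow (by positivity) (by positivity), ← Real.exp_mul,
          div_mul_cancel₀ _ hq.ne']

lemma lintegral_rpow_le_of_le_log {α : Type*} [MeasurableSpace α] {μ : Measure α}
    {U : α → ENNReal} {w : α → ℝ} (hw : Measurable w) (hw0 : ∀ x, 0 ≤ w x) {A B C F b M t : ℝ}
    (hA : 0 ≤ A) (hB : 0 ≤ B) (hC : 0 ≤ C) (hF : 0 ≤ F) (hb : 0 < b) (hM : 0 < M) (ht : 1 ≤ t)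
    (hμ : μ univ ≤ ENNReal.ofReal C)
    (hwC : ∫⁻ x, ENNReal.ofReal ((1 + w x) ^ M) ∂μ ≤ ENNReal.ofReal C)
    (hU : ∀ᵐ x ∂μ, U x ≤ ENNReal.ofReal (F * (A * Real.log (1 + w x) ^ b + B))) :
    (∫⁻ x, U x ^ t ∂μ) ^ (1 / t) ≤
      ENNReal.ofReal (F * (C ^ (1 / t) * (A * (b * t / (M * Real.exp 1)) ^ b + B))) := by
  have ht0 : 0 < t := by linarith
  have hlog0 : ∀ x, 0 ≤ Real.log (1 + w x) := fun x => Real.log_nonneg (by linarith [hw0 x])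
  have hC1 : μ univ ^ (1 / t) ≤ ENNReal.ofReal (C ^ (1 / t)) := by
    rw [← ENNReal.ofReal_rpow_of_nonneg hC (by positivity)]
    gcongr
  have hlogt : (∫⁻ x, ENNReal.ofReal (Real.log (1 + w x) ^ b) ^ t ∂μ) ^ (1 / t) ≤
      ENNReal.ofReal (C ^ (1 / t) * (b * t / (M * Real.exp 1)) ^ b) := by
    set E := b * t / (M * Real.exp 1) with hE
    have hE0 : 0 ≤ E := by positivity
    calc (∫⁻ x, ENNReal.ofReal (Real.log (1 + w x) ^ b) ^ t ∂μ) ^ (1 / t)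
        ≤ (∫⁻ x, ENNReal.ofReal (E ^ (b * t)) * ENNReal.ofReal ((1 + w x) ^ M) ∂μ) ^ (1 / t) := by
          gcongr with x
          rw [ENNReal.ofReal_rpow_of_nonneg (Real.rpow_nonneg (hlog0 x) _) ht0.le,
            ← Real.rpow_mul (hlog0 x), ← ENNReal.ofReal_mul (by positivity)]
          refine ENNReal.ofReal_le_ofReal
            ((rpow_le_mul_exp (hlog0 x) (by positivity) hM).trans_eq ?_)
          rw [Real.rpow_def_of_pos (show 0 < 1 + w x by linarith [hw0 x]),
            mul_comm (Real.log (1 + w x)) M]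
      _ ≤ (ENNReal.ofReal (E ^ (b * t)) * ENNReal.ofReal C) ^ (1 / t) := by
          rw [lintegral_const_mul _ (by fun_prop)]
          gcongr
      _ = _ := by
          rw [← ENNReal.ofReal_mul (by positivity),
            ENNReal.ofReal_rpow_of_nonneg (by positivity) (by positivity),
            Real.mul_rpow (by positivity) hC, ← Real.rpow_mul hE0, mul_comm (C ^ (1 / t))]
          congr 3
          field_simp
  calc (∫⁻ x, U x ^ t ∂μ) ^ (1 / t)
      ≤ (∫⁻ x, (((fun x => ENNReal.ofReal (F * A) * ENNReal.ofReal (Real.log (1 + w x) ^ b)) +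
          (fun _ => ENNReal.ofReal (F * B)) : α → ENNReal) x) ^ t ∂μ) ^ (1 / t) := by
        refine ENNReal.rpow_le_rpow (lintegral_mono_ae ?_) (by positivity)
        filter_upwards [hU] with x hx
        refine ENNReal.rpow_le_rpow (hx.trans_eq ?_) ht0.le
        have := Real.rpow_nonneg (hlog0 x) b
        rw [Pi.add_apply, ← ENNReal.ofReal_mul (by positivity),
          ← ENNReal.ofReal_add (by positivity) (by positivity)]
        congr 1
        ring
    _ ≤ (∫⁻ x, (ENNReal.ofReal (F * A) * ENNReal.ofReal (Real.log (1 + w x) ^ b)) ^ t ∂μ) ^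
          (1 / t) + (∫⁻ _, ENNReal.ofReal (F * B) ^ t ∂μ) ^ (1 / t) :=
        ENNReal.lintegral_Lp_add_le (by fun_prop) (by fun_prop) ht
    _ ≤ ENNReal.ofReal (F * A) * ENNReal.ofReal (C ^ (1 / t) * (b * t / (M * Real.exp 1)) ^ b) +
          ENNReal.ofReal (F * B) * ENNReal.ofReal (C ^ (1 / t)) := by
        simp_rw [ENNReal.mul_rpow_of_nonneg _ _ ht0.le]
        rw [lintegral_const_mul _ (by fun_prop), lintegral_const,
          ENNReal.mul_rpow_of_nonneg _ _ (by positivity),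
          ENNReal.mul_rpow_of_nonneg _ _ (by positivity), ← ENNReal.rpow_mul, ← ENNReal.rpow_mul,
          mul_one_div_cancel ht0.ne', ENNReal.rpow_one, ENNReal.rpow_one]
        gcongr
    _ = _ := by
        rw [← ENNReal.ofReal_mul (by positivity), ← ENNReal.ofReal_mul (by positivity),
          ← ENNReal.ofReal_add (by positivity) (by positivity)]
        congr 1
        ring

end LogEstimate

section Embedding

variable {N : ℕ} {h : Euc N → ℝ}

lemma IsGauge.exists_sub_lt (hh : IsGauge N h) {Ω : Set (Euc N)} (hΩ : Bornology.IsBounded Ω) :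
    ∃ R, 0 < R ∧ ∀ x ∈ Ω, ∀ y, x + y ∈ Ω → h y < R := by
  obtain ⟨C, hC, hle⟩ := hh.le
  obtain ⟨r, hr⟩ := hΩ.exists_norm_le
  refine ⟨C * (2 * |r|) + 1, by positivity, fun x hx y hy => ?_⟩
  have h1 : ‖y‖ ≤ 2 * |r| := by
    calc ‖y‖ = ‖(x + y) - x‖ := by rw [add_sub_cancel_left]
      _ ≤ ‖x + y‖ + ‖x‖ := norm_sub_le _ _
      _ ≤ |r| + |r| := add_le_add ((hr _ hy).trans (le_abs_self r)) ((hr _ hx).trans (le_abs_self r))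
      _ = 2 * |r| := by ring
  calc h y ≤ C * ‖y‖ := hle y
    _ ≤ C * (2 * |r|) := by gcongr
    _ < _ := by linarith

lemma lintegral_one_add_rpow_le {V : Euc N → ENNReal} (hV : Measurable V) {Ω : Set (Euc N)}
    {p F : ℝ} (hp : 1 ≤ p) (hF : 0 < F) {K : ENNReal}
    (hVK : ∫⁻ x, V x ^ p ≤ K * ENNReal.ofReal F ^ p) :
    ∫⁻ x in Ω, ENNReal.ofReal ((1 + (V x).toReal / F) ^ p) ≤ 2 ^ (p - 1) * (volume Ω + K) := by
  have hp0 : 0 < p := by linarith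
  have hF' : ENNReal.ofReal F ≠ 0 := by simpa using hF
  calc ∫⁻ x in Ω, ENNReal.ofReal ((1 + (V x).toReal / F) ^ p)
      ≤ ∫⁻ x in Ω, 2 ^ (p - 1) * (1 + (ENNReal.ofReal F ^ p)⁻¹ * V x ^ p) := by
        refine lintegral_mono fun x => ?_
        rw [← ENNReal.ofReal_rpow_of_nonneg (by positivity) hp0.le,
          ENNReal.ofReal_add zero_le_one (by positivity), ENNReal.ofReal_one]
        refine (ENNReal.rpow_add_le_mul_rpow_add_rpow _ _ hp).trans ?_
        rw [ENNReal.one_rpow, ENNReal.ofReal_div_of_pos hF, ENNReal.div_eq_inv_mul,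
          ENNReal.mul_rpow_of_nonneg _ _ hp0.le, ENNReal.inv_rpow]
        gcongr
        exact ENNReal.ofReal_toReal_le
    _ = 2 ^ (p - 1) * (volume Ω + (ENNReal.ofReal F ^ p)⁻¹ * ∫⁻ x in Ω, V x ^ p) := by
        rw [lintegral_const_mul _ (by fun_prop), lintegral_add_left (by fun_prop),
          lintegral_const_mul _ (by fun_prop)]
        simp
    _ ≤ 2 ^ (p - 1) * (volume Ω + K) := by
        gcongr
        calc (ENNReal.ofReal F ^ p)⁻¹ * ∫⁻ x in Ω, V x ^ p
            ≤ (ENNReal.ofReal F ^ p)⁻¹ * (K * ENNReal.ofReal F ^ p) := by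
              gcongr; exact (setLIntegral_le_lintegral _ _).trans hVK
          _ = K := by
              rw [mul_comm K, ← mul_assoc, ENNReal.inv_mul_cancel, one_mul]
              · simp [hF, hp0]
              · simp [hp0.le]

lemma IsGauge.exists_lintegral_rpow_le (hN : 2 ≤ N) (hh : IsGauge N h) {Ω : Set (Euc N)}
    (hΩo : IsOpen Ω) (hΩ : Bornology.IsBounded Ω) {a : ℝ} (ha : 0 < a) (ha1 : a < 1) :
    ∃ C B : ℝ, 0 < C ∧ 0 ≤ B ∧ ∀ t : ℝ, 1 ≤ t → ∀ u : Euc N → ℝ, ContDiff ℝ 1 u →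
      HasCompactSupport u → ∀ G : Euc N → ℝ, Measurable G →
      (∀ x z, |⟪gradient u x, z⟫| ≤ h z * G x) → (∀ x, x ∉ Ω → G x = 0) → ∀ F : ℝ, 0 < F →
      ∫⁻ x, ENNReal.ofReal (G x) ^ (N : ℝ) ≤ ENNReal.ofReal F ^ (N : ℝ) →
      (∫⁻ x in Ω, (N * volume {y | h y < 1} * ‖u x‖ₑ) ^ t) ^ (1 / t) ≤
        ENNReal.ofReal (F * (C ^ (1 / t) *
          ((N * (volume {y | h y < 1}).toReal / a) ^ (((N : ℝ) - 1) / N) *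
            (((N : ℝ) - 1) / N * t / (N * Real.exp 1)) ^ (((N : ℝ) - 1) / N) + B))) := by
  have hm : Measurable h := hh.continuous.measurable
  have hN1 : (1 : ℝ) < N := by exact_mod_cast hN
  have hN0 : N ≠ 0 := by omega
  have hb0 : 0 < ((N : ℝ) - 1) / N := div_pos (by linarith) (by linarith)
  have hb1 : ((N : ℝ) - 1) / N ≤ 1 := (div_le_one (by linarith)).2 (by linarith)
  obtain ⟨R, hR, hΩR⟩ := hh.exists_sub_lt hΩ
  set κ := (volume {y | h y < 1}).toReal with hκ
  have hκ0 : 0 ≤ κ := ENNReal.toReal_nonneg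
  set μ := (volume.restrict {y | h y < R}).withDensity
    fun y => ENNReal.ofReal (h y ^ (1 - N - a)) with hμ
  have hμ_int : ∀ g : Euc N → ENNReal, Measurable g → ∫⁻ y, g y ∂μ =
      ∫⁻ y in {y | h y < R}, g y * ENNReal.ofReal (h y ^ (1 - N - a)) := by
    intro g hg
    rw [hμ, lintegral_withDensity_eq_lintegral_mul _ (by fun_prop) hg]
    refine lintegral_congr fun y => ?_
    rw [Pi.mul_apply, mul_comm]
  have hμ_fin : μ univ < ⊤ := by
    rw [← lintegral_one, hμ_int _ measurable_const]
    have := hh.setLIntegral_rpow_lt_top hN0 (p := N - 1 + a) (by linarith) (by linarith) hR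
    simpa only [one_mul, neg_add, neg_sub, ← sub_eq_add_neg] using this
  have hΩ_fin : volume Ω < ⊤ := hΩ.measure_lt_top
  set C₀ : ENNReal := 2 ^ ((N : ℝ) - 1) * (volume Ω + μ univ ^ (N : ℝ)) with hC₀
  have hC₀_fin : C₀ < ⊤ := by
    refine ENNReal.mul_lt_top (ENNReal.rpow_lt_top_of_nonneg (by linarith) (by simp))
      (ENNReal.add_lt_top.2 ⟨hΩ_fin, ENNReal.rpow_lt_top_of_nonneg (by linarith) hμ_fin.ne⟩)
  have hC₀_le : C₀ ≤ ENNReal.ofReal (C₀.toReal + 1) := by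
    rw [ENNReal.le_ofReal_iff_toReal_le hC₀_fin.ne (by positivity)]
    linarith
  have hΩC₀ : volume Ω ≤ C₀ := by
    calc volume Ω ≤ 1 * (volume Ω + μ univ ^ (N : ℝ)) := by rw [one_mul]; exact le_self_add
      _ ≤ C₀ := by
        rw [hC₀]
        gcongr
        exact ENNReal.one_le_rpow (by norm_num) (by linarith)
  refine ⟨C₀.toReal + 1, κ ^ (((N : ℝ) - 1) / N) + R ^ a, by positivity, by positivity, ?_⟩
  intro t ht u hu hc G hGm hG hGΩ F hF hGF
  set f : Euc N → ENNReal := fun x => ENNReal.ofReal (G x) with hf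
  have hfm : Measurable f := by fun_prop
  set V : Euc N → ENNReal := fun x => ∫⁻ y, f (x + y) ∂μ with hVdef
  have hVm : Measurable V :=
    Measurable.lintegral_prod_right' (f := fun q : Euc N × Euc N => f (q.1 + q.2)) (by fun_prop)
  have hVN : ∫⁻ x, V x ^ (N : ℝ) ≤ μ univ ^ (N : ℝ) * ENNReal.ofReal F ^ (N : ℝ) :=
    (lintegral_rpow_average_le hfm μ hN1).trans (by gcongr)
  have hVfin : ∀ᵐ x, V x < ⊤ := by
    have hlt : ∫⁻ x, V x ^ (N : ℝ) < ⊤ := hVN.trans_lt (ENNReal.mul_lt_top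
      (ENNReal.rpow_lt_top_of_nonneg (by linarith) hμ_fin.ne)
      (ENNReal.rpow_lt_top_of_nonneg (by linarith) (by simp)))
    filter_upwards [ae_lt_top (by fun_prop) hlt.ne] with x hx
    exact (ENNReal.rpow_lt_top_iff_of_pos (by linarith)).1 hx
  refine lintegral_rpow_le_of_le_log (μ := volume.restrict Ω) (w := fun x => (V x).toReal / F)
    (by fun_prop) (fun x => by positivity) (by positivity) (by positivity) (by positivity) hF.le
    hb0 (by linarith) ht ?_ ((lintegral_one_add_rpow_le hVm hN1.le hF hVN).trans hC₀_le) ?_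
  · rw [Measure.restrict_apply_univ]
    exact hΩC₀.trans hC₀_le
  filter_upwards [ae_restrict_mem hΩo.measurableSet, ae_restrict_of_ae hVfin] with x hxΩ hxV
  have hsupp : ∀ y, f (x + y) ≠ 0 → h y < R := by
    intro y hy
    refine hΩR x hxΩ y ?_
    by_contra hxy
    exact hy (by simp [hf, hGΩ _ hxy])
  have hVx : V x = ∫⁻ y in {y | h y < R}, f (x + y) * ENNReal.ofReal (h y ^ (1 - N - a)) :=
    hμ_int _ (by fun_prop)
  refine (hh.enorm_le_potential hN0 hu hc hGm hG x).trans
    ((hh.potential_le_log hN hfm hF ha hR hGF x hsupp (hVx ▸ hxV)).trans ?_)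
  rw [← hVx]
  have hlog0 : 0 ≤ Real.log (1 + (V x).toReal / F) :=
    Real.log_nonneg (le_add_of_nonneg_right (by positivity))
  refine ENNReal.ofReal_le_ofReal (mul_le_mul_of_nonneg_left ?_ hF.le)
  rw [← add_assoc]
  gcongr
  rw [← Real.mul_rpow (by positivity) hlog0]
  refine le_trans (le_of_eq ?_) (Real.rpow_add_le_add_rpow (by positivity) hκ0 hb0.le hb1)
  congr 1
  ring

end Embedding

section SharpConstant

lemma exists_tendsto_of_forall_bound {D : ℕ → ℝ → ℝ} {l : ℕ → ℝ} {c : ℝ} {I : Set ℝ} (hc : 0 < c)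
    (hD : ∀ n, ∀ t ∈ I, 0 ≤ D n t) (hI : I ∈ atTop)
    (hlim : ∀ n, Tendsto (D n) atTop (𝓝 (l n))) (hl : Tendsto l atTop (𝓝 c)) :
    ∃ E : ℝ → ℝ, (∀ t, 0 < E t) ∧
      (∀ t ∈ I, ∀ X Y : ℝ, 0 ≤ Y → (∀ n, X ≤ D n t * Y) → X ≤ E t * Y) ∧
      Tendsto E atTop (𝓝 c) := by
  refine ⟨fun t => max c (⨅ n, D n t), fun t => lt_max_of_lt_left hc, ?_, ?_⟩
  · intro t ht X Y hY hX
    calc X ≤ (⨅ n, D n t) * Y := by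
          rw [Real.iInf_mul_of_nonneg hY]
          exact le_ciInf hX
      _ ≤ _ := by gcongr; exact le_max_right _ _
  · refine tendsto_order.2 ⟨fun b hb => Eventually.of_forall fun t => lt_max_of_lt_left hb,
      fun b hb => ?_⟩
    obtain ⟨n, hn⟩ := ((tendsto_order.1 hl).2 b hb).exists
    filter_upwards [(tendsto_order.1 (hlim n)).2 b hn, hI] with t ht htI
    refine max_lt hb ((ciInf_le ⟨0, ?_⟩ n).trans_lt ht)
    rintro _ ⟨m, rfl⟩
    exact hD m t htI

lemma tendsto_sobolev_bound {C B b A M K : ℝ} (hC : 0 < C) (hb : 0 < b) :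
    Tendsto (fun t : ℝ => M⁻¹ * (C ^ (1 / t) * (A * K + B * t ^ (-b)))) atTop
      (𝓝 (M⁻¹ * (A * K))) := by
  have h1 : Tendsto (fun t : ℝ => C ^ (1 / t)) atTop (𝓝 1) := by
    have := (Real.continuousAt_const_rpow (a := C) (b := 0) hC.ne').tendsto.comp
      tendsto_inv_atTop_zero
    simpa [Function.comp_def] using this
  have h2 : Tendsto (fun t : ℝ => A * K + B * t ^ (-b)) atTop (𝓝 (A * K + B * 0)) :=
    ((tendsto_rpow_neg_atTop hb).const_mul B).const_add _
  simpa using (h1.mul h2).const_mul M⁻¹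

lemma sharp_constant_eq {N κ : ℝ} (hN : 1 < N) (hκ : 0 < κ) :
    (N * κ)⁻¹ * ((N * κ) ^ ((N - 1) / N) * ((N - 1) / N / (N * Real.exp 1)) ^ ((N - 1) / N)) =
      1 / (N * κ ^ (1 / N)) * ((N - 1) / (N * Real.exp 1)) ^ ((N - 1) / N) := by
  have hN0 : 0 < N := by linarith
  have hN1 : 0 < N - 1 := by linarith
  have h1 : (N * κ) ^ ((N - 1) / N) = N ^ ((N - 1) / N) * (κ * (κ ^ (1 / N))⁻¹) := by
    rw [Real.mul_rpow hN0.le hκ.le, ← Real.rpow_neg hκ.le]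
    congr 1
    rw [show κ * κ ^ (-(1 / N)) = κ ^ (1 : ℝ) * κ ^ (-(1 / N)) by rw [Real.rpow_one],
      ← Real.rpow_add hκ]
    congr 1
    field_simp
    ring
  have h2 : ((N - 1) / N / (N * Real.exp 1)) ^ ((N - 1) / N) =
      ((N - 1) / (N * Real.exp 1)) ^ ((N - 1) / N) * (N ^ ((N - 1) / N))⁻¹ := by
    rw [← Real.inv_rpow hN0.le, ← Real.mul_rpow (by positivity) (by positivity)]
    congr 1
    field_simp
  have h3 : N ^ ((N - 1) / N) ≠ 0 := by positivity
  have h4 : κ ^ (1 / N) ≠ 0 := by positivity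
  rw [h1, h2]
  field_simp

variable {N : ℕ} {H : Euc N → ℝ}

lemma abs_inner_le_dualNorm_mul (hN : N ≠ 0) (hnorm : IsFinslerNorm N H) (hc : Continuous H)
    (ξ z : Euc N) : |⟪ξ, z⟫| ≤ dualNorm H z * H ξ := by
  obtain ⟨m, M, hm, -, hb⟩ := hnorm.exists_bounds hN hc
  have hH0 : H 0 = 0 := (hnorm.2.2.1 0).2 rfl
  have hle := fun ξ => inner_le_dualNorm_mul hH0 hm (fun ξ => (hb ξ).1) z ξ
  rw [real_inner_comm, abs_le']
  refine ⟨hle ξ, ?_⟩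
  simpa [hnorm.neg] using hle (-ξ)

lemma exists_sobolev_bound (hN : 2 ≤ N) (hnorm : IsFinslerNorm N H) (hreg : FinslerRegular N H)
    {Ω : Set (Euc N)} (hΩo : IsOpen Ω) (hΩ : Bornology.IsBounded Ω) {a : ℝ} (ha : 0 < a)
    (ha1 : a < 1) :
    ∃ C B : ℝ, 0 < C ∧ 0 ≤ B ∧ ∀ t : ℝ, 1 ≤ t → ∀ u : Euc N → ℝ, ContDiff ℝ 1 u →
      HasCompactSupport u → tsupport u ⊆ Ω →
      (∫ x in Ω, |u x| ^ t) ^ (1 / t) ≤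
        (N * wulffVol N H)⁻¹ * (C ^ (1 / t) * ((N * wulffVol N H / a) ^ (((N : ℝ) - 1) / N) *
          (((N : ℝ) - 1) / N / (N * Real.exp 1)) ^ (((N : ℝ) - 1) / N) +
            B * t ^ (-(((N : ℝ) - 1) / N)))) *
          (t ^ (((N : ℝ) - 1) / N) * (∫ x in Ω, H (gradient u x) ^ N) ^ (1 / (N : ℝ))) := by
  have hN0 : N ≠ 0 := by omega
  have hN1 : (1 : ℝ) < N := by exact_mod_cast hN
  have hHc := hreg.continuous hN0 hnorm
  have hh := isGauge_dualNorm hN0 hnorm hHc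
  have hH0 : H 0 = 0 := (hnorm.2.2.1 0).2 rfl
  obtain ⟨C, B, hC, hB, hmain⟩ := hh.exists_lintegral_rpow_le hN hΩo hΩ ha ha1
  refine ⟨C, B, hC, hB, fun t ht u hu hc huΩ => ?_⟩
  have ht0 : 0 < t := by linarith
  set b := ((N : ℝ) - 1) / N with hbdef
  have hb0 : 0 < b := div_pos (by linarith) (by linarith)
  set κ := wulffVol N H with hκ
  have hκ' : volume {y | dualNorm H y < 1} = ENNReal.ofReal κ :=
    (ENNReal.ofReal_toReal hh.volume_lt_top.ne).symm
  have hκ0 : 0 < κ := ENNReal.toReal_pos hh.volume_pos.ne' hh.volume_lt_top.ne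
  have hgrad : Continuous (gradient u) :=
    (InnerProductSpace.toDual ℝ (Euc N)).symm.continuous.comp (hu.continuous_fderiv one_ne_zero)
  set G : Euc N → ℝ := fun x => H (gradient u x) with hG
  have hGc : Continuous G := hHc.comp hgrad
  have hG0 : ∀ x, 0 ≤ G x := fun x => hnorm.2.1 _
  have hGsupp : ∀ x, x ∉ tsupport u → G x = 0 := by
    intro x hx
    have : fderiv ℝ u x = 0 := by
      by_contra hne
      exact hx (support_fderiv_subset ℝ hne)
    simp [hG, gradient, this, hH0]
  have hGint : Integrable fun x => G x ^ N := by
    refine Continuous.integrable_of_hasCompactSupport (by fun_prop) ?_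
    exact HasCompactSupport.intro hc fun x hx => by simp [hGsupp x hx, hN0]
  have huint : Integrable (fun x => |u x| ^ t) := by
    refine Continuous.integrable_of_hasCompactSupport
      (hu.continuous.abs.rpow_const fun _ => Or.inr ht0.le) ?_
    exact HasCompactSupport.intro hc fun x hx => by
      simp [image_eq_zero_of_notMem_tsupport hx, ht0.ne']
  set I := ∫ x in Ω, G x ^ N with hI
  have hI0 : 0 ≤ I := integral_nonneg fun x => pow_nonneg (hG0 x) N
  set Y := I ^ (1 / (N : ℝ)) with hY
  have hY0 : 0 ≤ Y := Real.rpow_nonneg hI0 _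
  set J := ∫ x in Ω, |u x| ^ t with hJ
  have hJ0 : 0 ≤ J := integral_nonneg fun x => by positivity
  have henergy : ∫⁻ x, ENNReal.ofReal (G x) ^ (N : ℝ) = ENNReal.ofReal I := by
    rw [hI, setIntegral_eq_integral_of_forall_compl_eq_zero
      (fun x hx => by simp [hGsupp x fun h => hx (huΩ h), hN0]),
      ofReal_integral_eq_lintegral_ofReal hGint (ae_of_all _ fun x => pow_nonneg (hG0 x) N)]
    refine lintegral_congr fun x => ?_
    rw [ENNReal.rpow_natCast, ENNReal.ofReal_pow (hG0 x)]
  have hnormt : (∫⁻ x in Ω, (N * volume {y | dualNorm H y < 1} * ‖u x‖ₑ) ^ t) ^ (1 / t) =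
      ENNReal.ofReal (N * κ * J ^ (1 / t)) := by
    have hpt : ∀ x, (N * volume {y | dualNorm H y < 1} * ‖u x‖ₑ) ^ t =
        ENNReal.ofReal (N * κ) ^ t * ENNReal.ofReal (|u x| ^ t) := by
      intro x
      rw [ENNReal.mul_rpow_of_nonneg _ _ ht0.le, hκ', ENNReal.ofReal_mul (by positivity),
        ENNReal.ofReal_natCast, Real.enorm_eq_ofReal_abs,
        ENNReal.ofReal_rpow_of_nonneg (abs_nonneg _) ht0.le]
    have hum := hu.continuous.measurable
    rw [lintegral_congr hpt, lintegral_const_mul _ (by fun_prop),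
      ← ofReal_integral_eq_lintegral_ofReal huint.integrableOn
        (ae_of_all _ fun x => by positivity),
      ENNReal.mul_rpow_of_nonneg _ _ (by positivity), ← ENNReal.rpow_mul,
      mul_one_div_cancel ht0.ne', ENNReal.rpow_one,
      ENNReal.ofReal_rpow_of_nonneg hJ0 (by positivity), ← ENNReal.ofReal_mul (by positivity)]
  set S := C ^ (1 / t) * ((N * κ / a) ^ b * (b * t / (N * Real.exp 1)) ^ b + B) with hS
  have hS0 : 0 ≤ S := by positivity
  have hbound : ∀ F, Y < F → N * κ * J ^ (1 / t) ≤ F * S := by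
    intro F hF
    have hF0 : 0 < F := hY0.trans_lt hF
    have := hmain t ht u hu hc G hGc.measurable
      (fun x z => abs_inner_le_dualNorm_mul hN0 hnorm hHc _ z)
      (fun x hx => hGsupp x fun h => hx (huΩ h)) F hF0 (by
        rw [henergy, ENNReal.ofReal_rpow_of_nonneg hF0.le (by linarith)]
        apply ENNReal.ofReal_le_ofReal
        calc I = Y ^ (N : ℝ) := by
              rw [hY, ← Real.rpow_mul hI0, one_div_mul_cancel (by linarith), Real.rpow_one]
          _ ≤ F ^ (N : ℝ) := by gcongr)
    rw [hnormt] at this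
    exact (ENNReal.ofReal_le_ofReal_iff (by positivity)).1 this
  have hfinal : N * κ * J ^ (1 / t) ≤ Y * S := by
    have hlim : Tendsto (fun F => F * S) (𝓝[>] Y) (𝓝 (Y * S)) :=
      (continuous_id.mul continuous_const).continuousAt.tendsto.mono_left nhdsWithin_le_nhds
    exact ge_of_tendsto hlim (by filter_upwards [self_mem_nhdsWithin] with F hF using hbound F hF)
  have hSt : S = C ^ (1 / t) * ((N * κ / a) ^ b * (b / (N * Real.exp 1)) ^ b + B * t ^ (-b)) *
      t ^ b := by
    have h1 : (b * t / (N * Real.exp 1)) ^ b = (b / (N * Real.exp 1)) ^ b * t ^ b := by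
      rw [← Real.mul_rpow (by positivity) ht0.le]
      congr 1
      ring
    have h2 : t ^ (-b) * t ^ b = 1 := by
      rw [← Real.rpow_add ht0, neg_add_cancel, Real.rpow_zero]
    rw [hS, h1]
    linear_combination (-C ^ (1 / t) * B) * h2
  calc J ^ (1 / t) ≤ (N * κ)⁻¹ * (Y * S) := by
        rw [le_inv_mul_iff₀ (by positivity)]
        exact hfinal
    _ = _ := by rw [hSt]; ring

end SharpConstant

/-- Refined Sobolev embedding with asymptotically sharp constant (Lemma 3.1). -/
theorem refined_sobolev (N : ℕ) (hN : 2 ≤ N) (H : Euc N → ℝ)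
    (hnorm : IsFinslerNorm N H) (hreg : FinslerRegular N H)
    (Ω : Set (Euc N)) (hΩo : IsOpen Ω) (hΩb : Bornology.IsBounded Ω) (hΩne : Ω.Nonempty) :
    ∃ D : ℝ → ℝ, (∀ t ≥ (2 : ℝ), 0 < D t) ∧
      (∀ t ≥ (2 : ℝ), ∀ u : Euc N → ℝ, ContDiff ℝ (⊤ : ℕ∞) u → HasCompactSupport u →
        tsupport u ⊆ Ω →
        (∫ x in Ω, |u x| ^ t) ^ (1 / t)
          ≤ D t * t ^ (((N : ℝ) - 1) / N) * (∫ x in Ω, H (gradient u x) ^ N) ^ (1 / (N : ℝ))) ∧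
      Tendsto D atTop
        (𝓝 (1 / (N * wulffVol N H ^ ((1 : ℝ) / N))
          * (((N : ℝ) - 1) / (N * Real.exp 1)) ^ (((N : ℝ) - 1) / N))) := by
  have hN0 : N ≠ 0 := by omega
  have hN1 : (1 : ℝ) < N := by exact_mod_cast hN
  have hb0 : 0 < ((N : ℝ) - 1) / N := div_pos (by linarith) (by linarith)
  have hh := isGauge_dualNorm hN0 hnorm (hreg.continuous hN0 hnorm)
  have hκ0 : 0 < wulffVol N H := ENNReal.toReal_pos hh.volume_pos.ne' hh.volume_lt_top.ne
  have hM0 : 0 < N * wulffVol N H := by positivity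
  have ha : ∀ n : ℕ, 0 < ((n : ℝ) / (n + 1) + 1) / 2 ∧ ((n : ℝ) / (n + 1) + 1) / 2 < 1 := by
    intro n
    have : (n : ℝ) / (n + 1) < 1 := (div_lt_one (by positivity)).2 (by linarith)
    exact ⟨by positivity, by linarith⟩
  have halim : Tendsto (fun n : ℕ => ((n : ℝ) / (n + 1) + 1) / 2) atTop (𝓝 1) := by
    have := ((tendsto_natCast_div_add_atTop (1 : ℝ)).add_const 1).div_const 2
    norm_num at this
    exact this
  choose C B hC hB hbound using fun n =>
    exists_sobolev_bound hN hnorm hreg hΩo hΩb (ha n).1 (ha n).2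
  have hlim := fun n => tendsto_sobolev_bound (C := C n) (B := B n) (b := ((N : ℝ) - 1) / N)
    (A := (N * wulffVol N H / (((n : ℝ) / (n + 1) + 1) / 2)) ^ (((N : ℝ) - 1) / N))
    (M := N * wulffVol N H) (K := (((N : ℝ) - 1) / N / (N * Real.exp 1)) ^ (((N : ℝ) - 1) / N))
    (hC n) hb0
  have hconst : Tendsto (fun n : ℕ => (N * wulffVol N H)⁻¹ *
      ((N * wulffVol N H / (((n : ℝ) / (n + 1) + 1) / 2)) ^ (((N : ℝ) - 1) / N) *
        (((N : ℝ) - 1) / N / (N * Real.exp 1)) ^ (((N : ℝ) - 1) / N))) atTop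
      (𝓝 (1 / (N * wulffVol N H ^ ((1 : ℝ) / N))
        * (((N : ℝ) - 1) / (N * Real.exp 1)) ^ (((N : ℝ) - 1) / N))) := by
    rw [← sharp_constant_eq hN1 hκ0]
    have hquot : Tendsto (fun n : ℕ => N * wulffVol N H / (((n : ℝ) / (n + 1) + 1) / 2)) atTop
        (𝓝 (N * wulffVol N H)) := by
      have := (tendsto_const_nhds (x := N * wulffVol N H)).div halim one_ne_zero
      rwa [div_one] at this
    exact ((hquot.rpow_const (Or.inl hM0.ne')).mul_const _).const_mul _
  have hc : 0 < 1 / (N * wulffVol N H ^ ((1 : ℝ) / N))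
      * (((N : ℝ) - 1) / (N * Real.exp 1)) ^ (((N : ℝ) - 1) / N) := by
    have : (0 : ℝ) < N - 1 := by linarith
    positivity
  obtain ⟨D, hDpos, hD, hDlim⟩ := exists_tendsto_of_forall_bound (I := Ici 2) hc
    (fun n t ht => by
      have ht0 : (0 : ℝ) < t := two_pos.trans_le ht
      have := (ha n).1
      have := hC n
      have := hB n
      positivity) (Ici_mem_atTop 2) hlim hconst
  refine ⟨D, fun t _ => hDpos t, fun t ht u hu hcs huΩ => ?_, hDlim⟩
  have ht0 : (0 : ℝ) < t := two_pos.trans_le ht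
  rw [mul_assoc]
  refine hD t ht _ _ ?_ fun n => hbound n t (one_le_two.trans ht) u (hu.of_le ?_) hcs huΩ
  · have : 0 ≤ ∫ x in Ω, H (gradient u x) ^ N :=
      integral_nonneg fun x => pow_nonneg (hnorm.2.1 _) N
    positivity
  · exact_mod_cast le_top
end
end

section
/- Let H : ℝ^N → ℝ be a norm with H ∈ C²(ℝ^N∖{0}), H^N ∈ C¹(ℝ^N), and the Hessian of H^N positive definite at every ξ ≠ 0, and let H⁰ be its dual norm, which under these assumptions is differentiable away from 0. Then for every x ∈ ℝ^N with x ≠ 0, H⁰(x) · ∇H(∇H⁰(x)) = x, where ∇H and ∇H⁰ denote the gradients of H and H⁰. -/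
open MeasureTheory Filter Real Set
open scoped RealInnerProductSpace Topology NNReal

noncomputable section

/-- **Danskin's theorem** for the support function of a compact set: it is differentiable
wherever the maximizer is unique, and its gradient is that maximizer. -/
theorem hasGradientAt_of_isGreatest_inner {E : Type*} [NormedAddCommGroup E]
    [InnerProductSpace ℝ E] [CompleteSpace E] {S : Set E} (hS : IsCompact S) {f : E → ℝ}
    (hf : ∀ z, IsGreatest ((fun ξ => ⟪z, ξ⟫) '' S) (f z)) {x ξ : E}
    (hξ : ∀ η ∈ S, ⟪x, η⟫ = f x → η = ξ) : HasGradientAt f ξ x := by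
  choose s hsS hs using fun z => (hf z).1
  simp only at hs
  have hle : ∀ z, ∀ η ∈ S, ⟪z, η⟫ ≤ f z := fun z η hη => (hf z).2 ⟨η, hη, rfl⟩
  have hsx : s x = ξ := hξ _ (hsS x) (hs x)
  obtain ⟨C, hC⟩ := hS.isBounded.exists_norm_le
  have hval : Tendsto (fun z => ⟪x, s z⟫) (𝓝 x) (𝓝 (f x)) := by
    have hlow : Tendsto (fun z => ⟪z, ξ⟫ - ‖z - x‖ * C) (𝓝 x) (𝓝 (f x)) := by
      have hcont : Continuous (fun z : E => ⟪z, ξ⟫ - ‖z - x‖ * C) := by fun_prop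
      have := hcont.tendsto x
      simpa [← hs x, hsx] using this
    refine tendsto_of_tendsto_of_tendsto_of_le_of_le hlow tendsto_const_nhds
      (fun z => ?_) (fun z => hle x _ (hsS z))
    have h1 : ⟪z, ξ⟫ ≤ ⟪z, s z⟫ := by rw [hs z, ← hsx]; exact hle z _ (hsS x)
    have h2 : ⟪z - x, s z⟫ ≤ ‖z - x‖ * C :=
      (real_inner_le_norm _ _).trans
        (mul_le_mul_of_nonneg_left (hC _ (hsS z)) (norm_nonneg _))
    rw [inner_sub_left] at h2
    simp only
    linarith
  have hsel : Tendsto s (𝓝 x) (𝓝 ξ) := by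
    refine hS.tendsto_nhds_of_unique_mapClusterPt (Eventually.of_forall hsS) fun η hη hcl => ?_
    refine hξ η hη ?_
    have hcl' : MapClusterPt ⟪x, η⟫ (𝓝 x) ((fun y => ⟪x, y⟫) ∘ s) :=
      hcl.continuousAt_comp (by fun_prop)
    exact eq_of_nhds_neBot (hcl'.clusterPt.mono hval)
  rw [hasGradientAt_iff_isLittleO, Asymptotics.isLittleO_iff]
  intro c hc
  filter_upwards [Metric.tendsto_nhds.1 hsel c hc] with z hz
  rw [dist_eq_norm] at hz
  have h1 : ⟪z, ξ⟫ ≤ f z := by rw [← hsx]; exact hle z _ (hsS x)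
  have h2 : ⟪x, s z⟫ ≤ f x := hle x _ (hsS z)
  have h3 : ⟪z - x, s z - ξ⟫ ≤ c * ‖z - x‖ := by
    rw [mul_comm]
    exact (real_inner_le_norm _ _).trans (mul_le_mul_of_nonneg_left hz.le (norm_nonneg _))
  have hfx : ⟪x, ξ⟫ = f x := by rw [← hsx]; exact hs x
  have hfz := hs z
  rw [real_inner_comm, Real.norm_eq_abs]
  simp only [inner_sub_left, inner_sub_right] at h3 ⊢
  rw [abs_of_nonneg (by linarith)]
  linarith

/-- If the second derivative of `f` at `m` is positive in the direction `v`, then `f` is not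
constant near `m` on the line through `m` with direction `v`. -/
theorem not_eventually_const_on_line_of_iteratedFDeriv_two_pos {E : Type*} [NormedAddCommGroup E]
    [NormedSpace ℝ E] {f : E → ℝ} {m v : E} (hf : ContDiffAt ℝ 2 f m)
    (hpos : 0 < iteratedFDeriv ℝ 2 f m ![v, v]) {c : ℝ} :
    ¬ ∀ᶠ t : ℝ in 𝓝 0, f (m + t • v) = c := by
  intro hconst
  have hline : ∀ t : ℝ, HasDerivAt (fun t : ℝ => m + t • v) v t := fun t => by
    simpa using ((hasDerivAt_id t).smul_const v).const_add m
  have htend : Tendsto (fun t : ℝ => m + t • v) (𝓝 0) (𝓝 m) := by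
    simpa using (hline 0).continuousAt.tendsto
  have hdiff : ∀ᶠ y in 𝓝 m, DifferentiableAt ℝ f y :=
    (hf.eventually (by simp)).mono fun y hy => hy.differentiableAt (by simp)
  have hfirst : ∀ᶠ t : ℝ in 𝓝 0, fderiv ℝ f (m + t • v) v = 0 := by
    filter_upwards [htend.eventually hdiff, hconst.eventually_nhds] with t ht hct
    have h1 : HasDerivAt (fun t : ℝ => f (m + t • v)) (fderiv ℝ f (m + t • v) v) t :=
      ht.hasFDerivAt.comp_hasDerivAt t (hline t)
    exact (h1.congr_of_eventuallyEq (hct.mono fun _ h => h.symm)).unique (hasDerivAt_const t c)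
  have hD : HasFDerivAt (fderiv ℝ f) (fderiv ℝ (fderiv ℝ f) m) (m + (0 : ℝ) • v) := by
    rw [zero_smul, add_zero]
    exact ((hf.fderiv_right (m := 1) (by norm_num)).differentiableAt (by simp)).hasFDerivAt
  have hDv : HasFDerivAt (fun y => fderiv ℝ f y v) ((fderiv ℝ (fderiv ℝ f) m).flip v)
      (m + (0 : ℝ) • v) := by
    simpa using hD.clm_apply (hasFDerivAt_const v _)
  have h2 : HasDerivAt (fun t : ℝ => fderiv ℝ f (m + t • v) v)
      ((fderiv ℝ (fderiv ℝ f) m).flip v v) 0 :=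
    HasFDerivAt.comp_hasDerivAt (l := fun y => fderiv ℝ f y v) (0 : ℝ) hDv (hline 0)
  have h3 : (fderiv ℝ (fderiv ℝ f) m).flip v v = 0 :=
    (h2.congr_of_eventuallyEq (hfirst.mono fun _ h => h.symm)).unique
      (hasDerivAt_const (0 : ℝ) (0 : ℝ))
  rw [iteratedFDeriv_two_apply] at hpos
  exact hpos.ne' h3

namespace IsFinslerNorm

variable {N : ℕ} {H : Euc N → ℝ}

theorem continuous (hH : IsFinslerNorm N H) : Continuous H :=
  continuousOn_univ.1 (hH.1.continuousOn isOpen_univ)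

theorem pos_s15 (hH : IsFinslerNorm N H) {ξ : Euc N} (hξ : ξ ≠ 0) : 0 < H ξ :=
  (hH.2.1 ξ).lt_of_ne fun h => hξ ((hH.2.2.1 ξ).1 h.symm)

theorem apply_inv_smul_self (hH : IsFinslerNorm N H) {ξ : Euc N} (hξ : ξ ≠ 0) :
    H ((H ξ)⁻¹ • ξ) = 1 := by
  rw [hH.2.2.2, abs_of_pos (inv_pos.2 (hH.pos_s15 hξ)), inv_mul_cancel₀ (hH.pos_s15 hξ).ne']

theorem ne_zero_of_apply_eq_one (hH : IsFinslerNorm N H) {ξ : Euc N} (hξ : H ξ = 1) : ξ ≠ 0 := by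
  rintro rfl
  rw [(hH.2.2.1 0).2 rfl] at hξ
  exact zero_ne_one hξ

theorem isCompact_unitSphere [Nontrivial (Euc N)] (hH : IsFinslerNorm N H) :
    IsCompact {ξ | H ξ = 1} := by
  obtain ⟨u, hu, hmin⟩ := (isCompact_sphere (0 : Euc N) 1).exists_isMinOn
    (NormedSpace.sphere_nonempty.2 zero_le_one) hH.continuous.continuousOn
  have hu0 : u ≠ 0 := by
    rintro rfl
    simp at hu
  have hcoer : ∀ ξ : Euc N, H u * ‖ξ‖ ≤ H ξ := fun ξ => by
    rcases eq_or_ne ξ 0 with rfl | hξ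
    · simpa using hH.2.1 0
    have hn : 0 < ‖ξ‖ := norm_pos_iff.2 hξ
    have h : H u ≤ H (‖ξ‖⁻¹ • ξ) := hmin (by simp [norm_smul, hn.ne'])
    rw [hH.2.2.2, abs_of_pos (inv_pos.2 hn)] at h
    calc H u * ‖ξ‖ ≤ ‖ξ‖⁻¹ * H ξ * ‖ξ‖ := by gcongr
      _ = H ξ := by field_simp
  refine Metric.isCompact_of_isClosed_isBounded
    (isClosed_singleton.preimage hH.continuous : IsClosed (H ⁻¹' {1})) ?_
  refine isBounded_iff_forall_norm_le.2 ⟨1 / H u, fun ξ hξ => ?_⟩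
  rw [le_div_iff₀ (hH.pos_s15 hu0), mul_comm]
  exact (hcoer ξ).trans_eq hξ

theorem isGreatest_dualNorm [Nontrivial (Euc N)] (hH : IsFinslerNorm N H) (z : Euc N) :
    IsGreatest ((fun ξ => ⟪z, ξ⟫) '' {ξ | H ξ = 1}) (dualNorm H z) := by
  obtain ⟨ξ₀, hξ₀⟩ := exists_ne (0 : Euc N)
  obtain ⟨g, hg⟩ := (hH.isCompact_unitSphere.image
    (by fun_prop : Continuous fun ξ : Euc N => ⟪z, ξ⟫)).exists_isGreatest
    ⟨_, _, hH.apply_inv_smul_self hξ₀, rfl⟩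
  have hset : {r : ℝ | ∃ ξ : Euc N, ξ ≠ 0 ∧ r = ⟪z, ξ⟫ / H ξ} =
      (fun ξ => ⟪z, ξ⟫) '' {ξ | H ξ = 1} := by
    ext r
    constructor
    · rintro ⟨ξ, hξ, rfl⟩
      exact ⟨_, hH.apply_inv_smul_self hξ, by simp [inner_smul_right, div_eq_inv_mul]⟩
    · rintro ⟨ξ, hξ, rfl⟩
      refine ⟨ξ, hH.ne_zero_of_apply_eq_one hξ, ?_⟩
      rw [show H ξ = 1 from hξ, div_one]
  rwa [dualNorm, hset, hg.csSup_eq]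

theorem inner_le_dualNorm_mul [Nontrivial (Euc N)] (hH : IsFinslerNorm N H) (z ξ : Euc N) :
    ⟪z, ξ⟫ ≤ dualNorm H z * H ξ := by
  rcases eq_or_ne ξ 0 with rfl | hξ
  · simp [(hH.2.2.1 0).2 rfl]
  have h := (hH.isGreatest_dualNorm z).2 ⟨_, hH.apply_inv_smul_self hξ, rfl⟩
  simp only [inner_smul_right] at h
  rwa [← div_eq_inv_mul, div_le_iff₀ (hH.pos_s15 hξ)] at h

theorem dualNorm_pos [Nontrivial (Euc N)] (hH : IsFinslerNorm N H) {x : Euc N} (hx : x ≠ 0) :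
    0 < dualNorm H x :=
  pos_of_mul_pos_left ((real_inner_self_pos.2 hx).trans_le (hH.inner_le_dualNorm_mul x x))
    (hH.2.1 x)

end IsFinslerNorm

/-- Strict convexity of the unit ball of `H`: a nonzero linear functional attains its maximum on
`{H = 1}` at only one point. -/
theorem FinslerRegular.eq_of_inner_eq_dualNorm {N : ℕ} {H : Euc N → ℝ} [Nontrivial (Euc N)]
    (hreg : FinslerRegular N H) (hH : IsFinslerNorm N H) {x ξ η : Euc N} (hx : x ≠ 0)
    (hξ : H ξ = 1) (hη : H η = 1) (hxξ : ⟪x, ξ⟫ = dualNorm H x)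
    (hxη : ⟪x, η⟫ = dualNorm H x) : ξ = η := by
  by_contra hne
  have hpos := hH.dualNorm_pos hx
  set m : Euc N := (1 / 2 : ℝ) • ξ + (1 / 2 : ℝ) • η with hm
  have hline : ∀ t : ℝ, m + t • (ξ - η) = (1 / 2 + t) • ξ + (1 / 2 - t) • η := fun t => by
    rw [hm]; module
  have hone : ∀ᶠ t : ℝ in 𝓝 0, H (m + t • (ξ - η)) ^ N = 1 := by
    filter_upwards [Ioo_mem_nhds (by norm_num : (-(1 / 2) : ℝ) < 0)
      (by norm_num : (0 : ℝ) < 1 / 2)] with t ht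
    have hle : H (m + t • (ξ - η)) ≤ 1 := by
      have := hH.1.2 (mem_univ ξ) (mem_univ η) (by linarith [ht.1] : (0 : ℝ) ≤ 1 / 2 + t)
        (by linarith [ht.2] : (0 : ℝ) ≤ 1 / 2 - t) (by ring)
      rw [hξ, hη] at this
      rw [hline]
      refine this.trans_eq ?_
      simp only [smul_eq_mul]
      ring
    have hge : 1 ≤ H (m + t • (ξ - η)) := by
      have := hH.inner_le_dualNorm_mul x (m + t • (ξ - η))
      rw [hline, inner_add_right, inner_smul_right, inner_smul_right, hxξ, hxη, ← hline] at this
      exact le_of_mul_le_mul_left (by linarith) hpos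
    rw [le_antisymm hle hge, one_pow]
  have hm0 : m ≠ 0 := by
    intro h0
    have : ⟪x, m⟫ = dualNorm H x := by
      rw [hm, inner_add_right, inner_smul_right, inner_smul_right, hxξ, hxη]
      ring
    rw [h0, inner_zero_right] at this
    exact hpos.ne this
  have hC2 : ContDiffAt ℝ 2 (fun ξ => H ξ ^ N) m :=
    (hreg.1.contDiffAt (isOpen_compl_singleton.mem_nhds hm0)).pow N
  exact not_eventually_const_on_line_of_iteratedFDeriv_two_pos hC2
    (hreg.2.2 m hm0 _ (sub_ne_zero.2 hne)) hone

/-- `H⁰(x) ∇H(∇H⁰(x)) = x` (Proposition 2.1 (5)). -/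
theorem dual_grad_identity (N : ℕ) (hN : 2 ≤ N) (H : Euc N → ℝ)
    (hnorm : IsFinslerNorm N H) (hreg : FinslerRegular N H) :
    ∀ x : Euc N, x ≠ 0 →
      dualNorm H x • gradient H (gradient (dualNorm H) x) = x := by
  intro x hx
  have : Nontrivial (Euc N) := ⟨x, 0, hx⟩
  obtain ⟨ξ, hξ, hxξ⟩ := (hnorm.isGreatest_dualNorm x).1
  have hgrad : gradient (dualNorm H) x = ξ :=
    (hasGradientAt_of_isGreatest_inner hnorm.isCompact_unitSphere hnorm.isGreatest_dualNorm
      fun η hη hxη => hreg.eq_of_inner_eq_dualNorm hnorm hx hη hξ hxη hxξ).gradient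
  rw [hgrad]
  have hdiff : DifferentiableAt ℝ H ξ :=
    (hreg.1.contDiffAt (isOpen_compl_singleton.mem_nhds
      (hnorm.ne_zero_of_apply_eq_one hξ))).differentiableAt (by simp)
  have hmin : IsLocalMin (fun η => dualNorm H x * H η - ⟪x, η⟫) ξ := by
    refine Eventually.of_forall fun η => ?_
    simp only at hxξ ⊢
    rw [hxξ, show H ξ = 1 from hξ]
    linarith [hnorm.inner_le_dualNorm_mul x η]
  have hzero := hmin.hasFDerivAt_eq_zero
    ((hdiff.hasGradientAt.hasFDerivAt.const_mul (dualNorm H x)).sub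
      (innerSL ℝ x).hasFDerivAt)
  refine ext_inner_right ℝ fun v => ?_
  have hv : dualNorm H x * ⟪gradient H ξ, v⟫ - ⟪x, v⟫ = 0 := DFunLike.congr_fun hzero v
  rw [real_inner_smul_left]
  linarith
end
end
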